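/- Let N be odd and not divisible by 3, and let C_N be the N×N adjacency matrix of the modular Collatz graph, i.e., C_N = P(π₂) + P(π₃) where P(π) is the permutation matrix of π, π₂(n) = 2⁻¹n mod N and π₃(n) = 2⁻¹(3n+1) mod N. Set K_N = ∑_{d|N} φ(d)/ord_d(3) (with ord_1(3):=1). Then det C_N = 0 if ord_p(3) is even for some prime p | N; otherwise det C_N = 2^{K_N} if N ≡ ±1 (mod 8) and det C_N = −2^{K_N} if N ≡ ±3 (mod 8). -/

import Mathlib

/-- Adjacency matrix of the modular Collatz graph for odd `N` not divisible by `3`: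
entry `(n, t)` counts the rules `t = 2⁻¹ n` and `t = 2⁻¹ (3n+1)`. -/
def collatzAdjMatrix (N : ℕ) [NeZero N] : Matrix (ZMod N) (ZMod N) ℤ :=
  fun n t => (if t = (2 : ZMod N)⁻¹ * n then 1 else 0) +
    (if t = (2 : ZMod N)⁻¹ * (3 * n + 1) then 1 else 0)

theorem permMatrix_apply_eq_ite {α : Type*} [DecidableEq α] (σ : Equiv.Perm α) (i j : α) :
    σ.permMatrix ℤ i j = if σ i = j then 1 else 0 := by
  simp [PEquiv.toMatrix_apply, Equiv.toPEquiv_apply, eq_comm]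

theorem det_one_add_permMatrix_mul {α : Type*} [Fintype α] [DecidableEq α]
    {σ τ : Equiv.Perm α} (h : σ.Disjoint τ) :
    2 ^ Fintype.card α * (1 + (σ * τ).permMatrix ℤ).det =
      (1 + σ.permMatrix ℤ).det * (1 + τ.permMatrix ℤ).det := by
  rw [← Matrix.det_mul, ← Matrix.det_smul]
  congr 1
  have hmul : σ.permMatrix ℤ * τ.permMatrix ℤ = (σ * τ).permMatrix ℤ := by
    rw [h.commute.eq, Matrix.permMatrix_mul]
  rw [add_mul, mul_add, mul_add, hmul, one_mul, one_mul, mul_one]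
  ext i j
  have hc : σ (τ i) = τ (σ i) := DFunLike.congr_fun h.commute.eq i
  simp only [Matrix.add_apply, Matrix.smul_apply, permMatrix_apply_eq_ite, Equiv.Perm.mul_apply,
    Matrix.one_apply, smul_eq_mul]
  rcases h i with hi | hi
  · simp only [hc, hi]; ring
  · simp only [hi]; ring

theorem Equiv.Perm.IsCycle.det_one_add_permMatrix {α : Type*} [Fintype α] [DecidableEq α]
    {σ : Equiv.Perm α} (hσ : σ.IsCycle) (hodd : Odd σ.support.card) :
    (1 + σ.permMatrix ℤ).det = 2 ^ (Fintype.card α - σ.support.card + 1) := by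
  have hprod : ∀ ρ : Equiv.Perm α, ρ = 1 ∨ ρ = σ →
      ∏ i, (1 + σ.permMatrix ℤ) i (ρ i) = 2 ^ (Fintype.card α - σ.support.card) := by
    intro ρ hρ
    rw [← Finset.card_compl, ← Finset.prod_const, ← Finset.prod_mul_prod_compl σ.support]
    have h1 : ∏ i ∈ σ.support, (1 + σ.permMatrix ℤ) i (ρ i) = 1 := by
      refine Finset.prod_eq_one fun i hi => ?_
      rw [Equiv.Perm.mem_support] at hi
      rcases hρ with rfl | rfl <;>
        simp [permMatrix_apply_eq_ite, hi, hi.symm, -Equiv.toPEquiv_apply,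
          -PEquiv.toMatrix_apply]
    rw [h1, one_mul]
    refine Finset.prod_congr rfl fun i hi => ?_
    rw [Finset.mem_compl, Equiv.Perm.mem_support, not_not] at hi
    rcases hρ with rfl | rfl <;> simp [hi]
  have hzero : ∀ ρ : Equiv.Perm α, ρ ∉ ({1, σ} : Finset (Equiv.Perm α)) →
      ∏ i, (1 + σ.permMatrix ℤ) i (ρ i) = 0 := by
    intro ρ hρ
    contrapose! hρ
    rw [Finset.prod_ne_zero_iff] at hρ
    have key : ∀ i, ρ i = i ∨ ρ i = σ i := by
      intro i
      have := hρ i (Finset.mem_univ i)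
      simp only [Matrix.add_apply, permMatrix_apply_eq_ite, Matrix.one_apply] at this
      by_contra! hn
      exact this (by simp [hn.1.symm, hn.2.symm])
    rw [Finset.mem_insert, Finset.mem_singleton]
    by_cases hall : ∀ i ∈ σ.support, ρ i = σ i
    · right
      ext i
      by_cases hi : i ∈ σ.support
      · exact hall i hi
      · rcases key i with h | h
        · rw [h, Equiv.Perm.notMem_support.1 hi]
        · exact h
    · left
      push Not at hall
      obtain ⟨x, hx, hne⟩ := hall
      have hfix : ∀ n : ℕ, ρ ((σ⁻¹ ^ n) x) = (σ⁻¹ ^ n) x := by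
        intro n
        induction n with
        | zero => simpa using (key x).resolve_right hne
        | succ n ih =>
          rw [pow_succ', Equiv.Perm.mul_apply]
          refine (key _).resolve_right fun h => ?_
          have h2 := ρ.injective ((h.trans (σ.apply_symm_apply _)).trans ih.symm)
          have h3 : σ ((σ⁻¹ ^ n) x) = (σ⁻¹ ^ n) x := by
            conv_lhs => rw [← h2]
            simp
          have h4 : (σ⁻¹ ^ n) x ∈ σ.support := by
            rw [inv_pow, ← zpow_natCast, ← zpow_neg, Equiv.Perm.zpow_apply_mem_support]
            exact hx
          exact Equiv.Perm.mem_support.1 h4 h3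
      ext i
      by_cases hi : i ∈ σ.support
      · obtain ⟨n, hn⟩ := (hσ.inv).exists_pow_eq
          (Equiv.Perm.mem_support.1 (σ.support_inv.symm ▸ hx))
          (Equiv.Perm.mem_support.1 (σ.support_inv.symm ▸ hi))
        rw [← hn]
        exact hfix n
      · rcases key i with h | h
        · exact h
        · rw [h, Equiv.Perm.notMem_support.1 hi]; rfl
  rw [← Matrix.det_transpose, Matrix.det_apply]
  simp only [Matrix.transpose_apply]
  rw [← Finset.sum_subset (Finset.subset_univ ({1, σ} : Finset (Equiv.Perm α)))
    fun ρ _ hρ => by rw [hzero ρ hρ, smul_zero], Finset.sum_pair hσ.ne_one.symm,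
    hprod 1 (Or.inl rfl), hprod σ (Or.inr rfl), hσ.sign, hodd.neg_one_pow]
  simp [pow_succ, mul_two]

open Function in
/-- For a permutation of odd order, `det (1 + P)` is `2` to the number of cycles, which is counted
here as the sum of the inverse periods of all points. -/
theorem exists_det_one_add_permMatrix {α : Type*} [Fintype α] [DecidableEq α]
    (σ : Equiv.Perm α) (hodd : Odd (orderOf σ)) :
    ∃ e : ℕ, (e : ℚ) = ∑ x, (minimalPeriod σ x : ℚ)⁻¹ ∧ (1 + σ.permMatrix ℤ).det = 2 ^ e := by
  induction σ using Equiv.Perm.cycle_induction_on with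
  | base_one =>
    refine ⟨Fintype.card α, ?_, ?_⟩
    · simp
    · rw [Matrix.permMatrix_one, ← two_smul ℤ, Matrix.det_smul, Matrix.det_one, mul_one]
  | base_cycles σ hσ =>
    refine ⟨_, ?_, hσ.det_one_add_permMatrix (hσ.orderOf ▸ hodd)⟩
    have hs : ∀ x ∈ σ.support, (minimalPeriod σ x : ℚ)⁻¹ = (σ.support.card : ℚ)⁻¹ := by
      intro x hx
      rw [← hσ.orderOf]
      congr 2
      refine Nat.dvd_right_iff_eq.1 fun n => ?_
      rw [orderOf_dvd_iff_pow_eq_one, hσ.pow_eq_one_iff' (Equiv.Perm.mem_support.1 hx),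
        ← isPeriodicPt_iff_minimalPeriod_dvd, IsPeriodicPt, IsFixedPt, Equiv.Perm.iterate_eq_pow]
    have hc : ∀ x ∈ σ.supportᶜ, (minimalPeriod σ x : ℚ)⁻¹ = 1 := by
      intro x hx
      rw [Finset.mem_compl, Equiv.Perm.notMem_support] at hx
      rw [minimalPeriod_eq_one_iff_isFixedPt.2 hx]
      simp
    rw [← Finset.sum_add_sum_compl σ.support, Finset.sum_congr rfl hs, Finset.sum_congr rfl hc]
    have : (σ.support.card : ℚ) ≠ 0 :=
      Nat.cast_ne_zero.2 (zero_lt_two.trans_le hσ.two_le_card_support).ne'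
    simp [Finset.card_compl, add_comm, mul_inv_cancel₀ this]
  | induction_disjoint σ τ h _ hσ hτ =>
    rw [h.orderOf] at hodd
    obtain ⟨a, ha, ha'⟩ := hσ (hodd.of_dvd_nat (Nat.dvd_lcm_left _ _))
    obtain ⟨b, hb, hb'⟩ := hτ (hodd.of_dvd_nat (Nat.dvd_lcm_right _ _))
    have hcomm : Function.Commute σ τ := fun x => DFunLike.congr_fun h.commute.eq x
    have hper : ∀ x, (minimalPeriod (σ * τ : Equiv.Perm α) x : ℚ)⁻¹ + 1 =
        (minimalPeriod σ x : ℚ)⁻¹ + (minimalPeriod τ x : ℚ)⁻¹ := by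
      intro x
      have hiter : ∀ n, (σ * τ : Equiv.Perm α)^[n] x = σ^[n] (τ^[n] x) := fun n => by
        rw [Equiv.Perm.coe_mul, hcomm.comp_iterate, comp_apply]
      rcases h x with hx | hx
      · have : minimalPeriod (σ * τ : Equiv.Perm α) x = minimalPeriod τ x := by
          refine minimalPeriod_eq_minimalPeriod_iff.2 fun n => ?_
          rw [IsPeriodicPt, IsFixedPt, hiter, (hcomm.iterate_iterate n n) x, iterate_fixed hx]
          rfl
        rw [this, minimalPeriod_eq_one_iff_isFixedPt.2 hx, add_comm]
        simp
      · have : minimalPeriod (σ * τ : Equiv.Perm α) x = minimalPeriod σ x := by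
          refine minimalPeriod_eq_minimalPeriod_iff.2 fun n => ?_
          rw [IsPeriodicPt, IsFixedPt, hiter, iterate_fixed hx]
          rfl
        rw [this, minimalPeriod_eq_one_iff_isFixedPt.2 hx]
        simp
    have hsum : ∑ x, (minimalPeriod (σ * τ : Equiv.Perm α) x : ℚ)⁻¹ + Fintype.card α = a + b := by
      rw [ha, hb, ← Finset.sum_add_distrib, ← Finset.sum_congr rfl fun x _ => hper x,
        Finset.sum_add_distrib]
      simp
    have hle : Fintype.card α ≤ a + b := by
      have : (0 : ℚ) ≤ ∑ x, (minimalPeriod (σ * τ : Equiv.Perm α) x : ℚ)⁻¹ :=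
        Finset.sum_nonneg fun x _ => by positivity
      exact_mod_cast (by linarith : (Fintype.card α : ℚ) ≤ a + b)
    refine ⟨a + b - Fintype.card α, ?_, ?_⟩
    · rw [Nat.cast_sub hle, Nat.cast_add]
      exact sub_eq_of_eq_add hsum.symm
    · have := det_one_add_permMatrix_mul h
      rw [ha', hb', ← pow_add, ← Nat.add_sub_of_le hle, pow_add] at this
      simpa using this


theorem exists_odd_dvd_pow_sub_one {N : ℕ} (a : ℤ) (hN : Odd N)
    (h : ∀ p : ℕ, p.Prime → p ∣ N → Odd (orderOf (a : ZMod p))) :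
    ∃ m : ℕ, Odd m ∧ (N : ℤ) ∣ a ^ m - 1 := by
  induction N using induction_on_primes with
  | zero => simp at hN
  | one => exact ⟨1, odd_one, by simp⟩
  | prime_mul p n hp ih =>
    obtain ⟨hpo, hno⟩ := Nat.odd_mul.1 hN
    obtain ⟨m, hm, hdvd⟩ := ih hno fun q hq hqn => h q hq (hqn.mul_left p)
    set k := orderOf (a : ZMod p) with hk
    have hk' : Odd k := h p hp (dvd_mul_right p n)
    have hp1 : (p : ℤ) ∣ a ^ (m * k) - 1 := by
      rw [← ZMod.intCast_zmod_eq_zero_iff_dvd]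
      push_cast
      rw [mul_comm, pow_mul, hk, pow_orderOf_eq_one, one_pow, sub_self]
    have hn1 : (n : ℤ) ∣ a ^ (m * k) - 1 := by
      rw [pow_mul]
      exact hdvd.trans (sub_one_dvd_pow_sub_one _ _)
    refine ⟨m * k * p, (hm.mul hk').mul hpo, ?_⟩
    rw [pow_mul, ← geom_sum_mul, Nat.cast_mul]
    refine mul_dvd_mul ?_ hn1
    rw [← ZMod.intCast_zmod_eq_zero_iff_dvd] at hp1 ⊢
    have : ((a ^ (m * k) : ℤ) : ZMod p) = 1 := by
      rw [← sub_eq_zero]; exact_mod_cast hp1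
    push_cast at this ⊢
    simp [this]

theorem minimalPeriod_natCast_mul {N : ℕ} (a : ℕ) (x : ZMod N) :
    Function.minimalPeriod (fun y : ZMod N => a * y) x = orderOf (a : ZMod (addOrderOf x)) := by
  refine Nat.dvd_right_iff_eq.1 fun n => ?_
  have h : (fun y : ZMod N => a * y)^[n] x = (a : ZMod N) ^ n * x := by
    rw [mul_left_iterate]
  rw [← Function.isPeriodicPt_iff_minimalPeriod_dvd, orderOf_dvd_iff_pow_eq_one,
    Function.IsPeriodicPt, Function.IsFixedPt, h, ← sub_eq_zero, ← sub_one_mul,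
    ← sub_eq_zero (b := (1 : ZMod (addOrderOf x)))]
  have h1 : ((a : ZMod N) ^ n - 1) * x = ((a : ℤ) ^ n - 1) • x := by
    rw [zsmul_eq_mul]; push_cast; rfl
  have h2 : (a : ZMod (addOrderOf x)) ^ n - 1 = (((a : ℤ) ^ n - 1 : ℤ) : ZMod (addOrderOf x)) := by
    push_cast; rfl
  rw [h1, h2, ZMod.intCast_zmod_eq_zero_iff_dvd, addOrderOf_dvd_iff_zsmul_eq_zero]

theorem orderOf_natCast_dvd_totient {d a : ℕ} (h : a.Coprime d) :
    orderOf (a : ZMod d) ∣ d.totient := by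
  rw [orderOf_dvd_iff_pow_eq_one, ← ZMod.coe_unitOfCoprime a h, ← Units.val_pow_eq_pow_val,
    ZMod.pow_totient, Units.val_one]

/-- The number of cycles of multiplication by `a` on `ZMod N`. -/
theorem sum_inv_minimalPeriod_natCast_mul {N : ℕ} [NeZero N] {a : ℕ} (h : a.Coprime N) :
    ∑ x : ZMod N, (Function.minimalPeriod (fun y : ZMod N => a * y) x : ℚ)⁻¹ =
      (∑ d ∈ N.divisors, d.totient / orderOf (a : ZMod d) : ℕ) := by
  have hmaps : ∀ x ∈ (Finset.univ : Finset (ZMod N)), addOrderOf x ∈ N.divisors := fun x _ => by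
    rw [Nat.mem_divisors]
    exact ⟨by simpa [ZMod.card] using addOrderOf_dvd_card (x := x), NeZero.ne N⟩
  rw [← Finset.sum_fiberwise_of_maps_to hmaps, Nat.cast_sum]
  refine Finset.sum_congr rfl fun d hd => ?_
  have hdN := Nat.dvd_of_mem_divisors hd
  have hdvd := orderOf_natCast_dvd_totient (h.coprime_dvd_right hdN)
  have hpos : 0 < d.totient := Nat.totient_pos.2 (Nat.pos_of_mem_divisors hd)
  rw [Nat.cast_div hdvd (by exact_mod_cast (Nat.pos_of_dvd_of_pos hdvd hpos).ne'),
    Finset.sum_congr rfl (g := fun _ => (orderOf (a : ZMod d) : ℚ)⁻¹), Finset.sum_const,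
    IsAddCyclic.card_addOrderOf_eq_totient (by rwa [ZMod.card]), nsmul_eq_mul, div_eq_mul_inv]
  intro x hx
  rw [minimalPeriod_natCast_mul, (Finset.mem_filter.1 hx).2]

/-- The sign of multiplication by `2` modulo `2 * m + 1`, obtained by counting inversions. -/
theorem sign_eq_of_val_eq_two_mul_mod (m : ℕ) (σ : Equiv.Perm (Fin (2 * m + 1)))
    (hσ : ∀ i, (σ i : ℕ) = 2 * i % (2 * m + 1)) :
    Equiv.Perm.sign σ = (-1) ^ (m * (m + 1) / 2) := by
  have hval : ∀ i : Fin (2 * m + 1), (σ i : ℕ) =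
      if (i : ℕ) ≤ m then 2 * (i : ℕ) else 2 * (i : ℕ) - (2 * m + 1) := by
    intro i
    rw [hσ]
    have := i.2
    split_ifs with h
    · exact Nat.mod_eq_of_lt (by omega)
    · rw [Nat.mod_eq_sub_mod (by omega), Nat.mod_eq_of_lt (by omega)]
  have hinner : ∀ j : Fin (2 * m + 1),
      ∏ i ∈ Finset.Iio j, (if σ i < σ j then (1 : ℤˣ) else -1) =
        (-1) ^ (if (j : ℕ) ≤ m then 0 else 2 * m + 1 - j) := by
    intro j
    have hj := j.2
    rw [Finset.prod_ite, Finset.prod_const_one, one_mul, Finset.prod_const]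
    congr 1
    have hset : ({i ∈ Finset.Iio j | ¬σ i < σ j}).map Fin.valEmbedding =
        if (j : ℕ) ≤ m then ∅ else Finset.Ico ((j : ℕ) - m) (m + 1) := by
      ext i
      simp only [Finset.mem_map, Finset.mem_filter, Finset.mem_Iio, Fin.lt_def, hval,
        Fin.valEmbedding_apply]
      constructor
      · rintro ⟨i, ⟨h1, h2⟩, rfl⟩
        split_ifs at h2 ⊢ <;> simp <;> omega
      · intro h
        split_ifs at h with hjm
        · simp at h
        · rw [Finset.mem_Ico] at h
          refine ⟨⟨i, by omega⟩, ⟨by simp; omega, ?_⟩, rfl⟩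
          simp only
          split_ifs <;> omega
    rw [← Finset.card_map Fin.valEmbedding, hset]
    split_ifs
    · rfl
    · rw [Nat.card_Ico]; omega
  rw [Equiv.Perm.sign_eq_prod_prod_Iio, Finset.prod_congr rfl fun j _ => hinner j,
    Finset.prod_pow_eq_pow_sum]
  congr 1
  rw [Fin.sum_univ_eq_sum_range (fun j => if j ≤ m then 0 else 2 * m + 1 - j) (2 * m + 1),
    show 2 * m + 1 = (m + 1) + m by ring, Finset.sum_range_add]
  rw [Finset.sum_eq_zero (s := Finset.range (m + 1)) fun j hj => if_pos (by
    rw [Finset.mem_range] at hj; omega), zero_add]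
  rw [Finset.sum_congr rfl (g := fun j => (m - 1 - j) + 1), Finset.sum_range_reflect (· + 1) m]
  · rw [← add_zero (∑ j ∈ Finset.range m, (j + 1)), ← Finset.sum_range_succ' (fun j => j),
      Finset.sum_range_id, Nat.add_sub_cancel, mul_comm]
  · intro j hj
    rw [Finset.mem_range] at hj
    rw [if_neg (by omega)]
    omega

theorem sign_eq_of_forall_eq_two_mul (m : ℕ) (σ : Equiv.Perm (ZMod (2 * m + 1)))
    (hσ : ∀ x, σ x = 2 * x) : Equiv.Perm.sign σ = (-1) ^ (m * (m + 1) / 2) := by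
  refine sign_eq_of_val_eq_two_mul_mod m σ fun i => ?_
  have h : ∀ x, (σ x).val = 2 * x.val % (2 * m + 1) := fun x => by
    rw [hσ, two_mul x, ZMod.val_add, two_mul x.val]
  exact h i

/-- Up to permuting rows and a translation, the Collatz matrix is `1` plus the permutation matrix
of multiplication by `3`. -/
theorem sign_mul_det_collatzAdjMatrix {N : ℕ} [NeZero N] (hN : Odd N) {σ τ : Equiv.Perm (ZMod N)}
    (hσ : ∀ x, σ x = 3 * x) (hτ : ∀ x, τ x = 2 * x) :
    Equiv.Perm.sign τ * (collatzAdjMatrix N).det = (1 + σ.permMatrix ℤ).det := by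
  have h2 : (2 : ZMod N) * 2⁻¹ = 1 := by
    exact_mod_cast ZMod.coe_mul_inv_eq_one 2 (Nat.coprime_two_left.2 hN)
  have hperm := Matrix.det_permute τ (collatzAdjMatrix N)
  rw [Int.cast_id] at hperm
  rw [← hperm,
    ← Matrix.det_submatrix_equiv_self (Equiv.subRight ((2 : ZMod N)⁻¹ * 2⁻¹))]
  congr 1
  ext x y
  simp only [collatzAdjMatrix, Matrix.submatrix_apply, Matrix.add_apply, permMatrix_apply_eq_ite,
    Matrix.one_apply, Equiv.subRight_apply, id_eq, hσ, hτ]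
  set u := (2 : ZMod N)⁻¹
  have e1 : u * (2 * (x - u * u)) = x - u * u := by linear_combination (x - u * u) * h2
  have e2 : u * (3 * (2 * (x - u * u)) + 1) = 3 * x - u * u := by
    linear_combination (3 * x - 3 * u * u - u) * h2
  rw [e1, e2]
  simp only [sub_left_inj, eq_comm]

theorem det_one_add_permMatrix_eq_zero {α : Type*} [Fintype α] [DecidableEq α] (σ : Equiv.Perm α)
    (v : α → ℤ) (hv : v ≠ 0) (h : ∀ x, v (σ x) = -v x) : (1 + σ.permMatrix ℤ).det = 0 := by
  rw [← Matrix.exists_mulVec_eq_zero_iff]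
  refine ⟨v, hv, ?_⟩
  rw [Matrix.add_mulVec, Matrix.one_mulVec, Matrix.permMatrix_mulVec]
  ext x
  simp [h]

theorem exists_apply_mul_eq_neg {R : Type*} [Monoid R] [DecidableEq R] (a : Rˣ)
    (ha : Even (orderOf a)) (hpos : 0 < orderOf a) :
    ∃ v : R → ℤ, v ≠ 0 ∧ ∀ x, v (a * x) = -v x := by
  refine ⟨fun y => ∑ i ∈ Finset.range (orderOf a), if y = (a ^ i : Rˣ) then (-1) ^ i else 0,
    fun h => ?_, fun x => ?_⟩
  · have h1 := congrFun h 1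
    simp only [Pi.zero_apply] at h1
    rw [Finset.sum_eq_single_of_mem 0 (Finset.mem_range.2 hpos)] at h1
    · simp at h1
    · intro i hi hi0
      refine if_neg fun h => hi0 ?_
      have : a ^ i = 1 := Units.ext h.symm
      exact Nat.eq_zero_of_dvd_of_lt (orderOf_dvd_of_pow_eq_one this) (Finset.mem_range.1 hi)
  · set g : ℕ → ℤ := fun i => if a * x = (a ^ i : Rˣ) then (-1) ^ i else 0 with hg
    have hends : g (orderOf a) = g 0 := by
      simp only [hg, pow_orderOf_eq_one, ha.neg_one_pow, pow_zero]
    have hshift : ∑ i ∈ Finset.range (orderOf a), g i =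
        ∑ i ∈ Finset.range (orderOf a), g (i + 1) := by
      have h1 := Finset.sum_range_succ g (orderOf a)
      rw [Finset.sum_range_succ', hends] at h1
      exact (add_right_cancel h1).symm
    refine hshift.trans ?_
    rw [← Finset.sum_neg_distrib]
    refine Finset.sum_congr rfl fun i _ => ?_
    simp only [hg, pow_succ' a, Units.val_mul, Units.mul_right_inj]
    split_ifs
    · ring
    · ring

theorem det_collatzAdjMatrix (N : ℕ) [NeZero N] (hodd : Odd N) (h3 : ¬ 3 ∣ N)
    (K : ℕ) (hK : K = ∑ d ∈ N.divisors, Nat.totient d / orderOf (3 : ZMod d)) :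
    ((∃ p : ℕ, p.Prime ∧ p ∣ N ∧ Even (orderOf (3 : ZMod p))) →
      (collatzAdjMatrix N).det = 0) ∧
    ((∀ p : ℕ, p.Prime → p ∣ N → Odd (orderOf (3 : ZMod p))) →
      ((N % 8 = 1 ∨ N % 8 = 7 → (collatzAdjMatrix N).det = 2 ^ K) ∧
       (N % 8 = 3 ∨ N % 8 = 5 → (collatzAdjMatrix N).det = -(2 ^ K)))) := by
  have hcop3 : Nat.Coprime 3 N := (Nat.Prime.coprime_iff_not_dvd Nat.prime_three).2 h3
  set a : (ZMod N)ˣ := ZMod.unitOfCoprime 3 hcop3 with ha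
  have ha3 : (a : ZMod N) = 3 := by simp [ha]
  set σ : Equiv.Perm (ZMod N) := Units.mulLeft a
  have hσ : ∀ x, σ x = 3 * x := fun x => by simp [σ, ha3]
  set τ : Equiv.Perm (ZMod N) :=
    Units.mulLeft (ZMod.unitOfCoprime 2 (Nat.coprime_two_left.2 hodd))
  have hτ : ∀ x, τ x = 2 * x := fun x => by simp [τ]
  have hdet := sign_mul_det_collatzAdjMatrix hodd hσ hτ
  refine ⟨?_, fun hp => ?_⟩
  · rintro ⟨p, -, hpN, heven⟩
    have hdvd : orderOf (3 : ZMod p) ∣ orderOf a := by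
      rw [← orderOf_units, ha3]
      have h := orderOf_map_dvd (ZMod.castHom hpN (ZMod p) : ZMod N →* ZMod p) 3
      rwa [MonoidHom.coe_coe, map_ofNat] at h
    obtain ⟨v, hv, hva⟩ := exists_apply_mul_eq_neg a (heven.trans_dvd hdvd) (orderOf_pos a)
    rw [det_one_add_permMatrix_eq_zero σ v hv hva] at hdet
    simpa using hdet
  · have hσodd : Odd (orderOf σ) := by
      obtain ⟨m, hm, hdvd⟩ := exists_odd_dvd_pow_sub_one 3 hodd (by exact_mod_cast hp)
      refine hm.of_dvd_nat (orderOf_dvd_of_pow_eq_one ?_)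
      have h1 : (3 : ZMod N) ^ m = 1 := by
        rw [← ZMod.intCast_zmod_eq_zero_iff_dvd] at hdvd
        rw [← sub_eq_zero]
        exact_mod_cast hdvd
      have hfun : (σ : ZMod N → ZMod N) = (3 * ·) := funext hσ
      ext x
      rw [← Equiv.Perm.iterate_eq_pow, hfun, mul_left_iterate]
      simp [h1]
    obtain ⟨e, he, hdetσ⟩ := exists_det_one_add_permMatrix σ hσodd
    have heK : e = K := by
      have hfun : (σ : ZMod N → ZMod N) = fun y => ((3 : ℕ) : ZMod N) * y := by
        funext x
        simp [hσ]
      rw [hfun, sum_inv_minimalPeriod_natCast_mul hcop3, Nat.cast_inj] at he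
      simpa [hK] using he
    obtain ⟨m, rfl⟩ := hodd
    rw [hdetσ, heK, sign_eq_of_forall_eq_two_mul m τ hτ] at hdet
    have hquot : ∀ q r, m = 4 * q + r →
        m * (m + 1) / 2 = 2 * (q * (4 * q + 2 * r + 1)) + r * (r + 1) / 2 := by
      rintro q r rfl
      rw [← Nat.mul_add_div two_pos]
      congr 1
      ring
    have hq := hquot (m / 4) (m % 4) (Nat.div_add_mod m 4).symm
    rw [hq, pow_add, pow_mul] at hdet
    constructor
    · intro hmod
      have hr : m % 4 = 0 ∨ m % 4 = 3 := by omega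
      rcases hr with hr | hr <;> simpa [hr] using hdet
    · intro hmod
      have hr : m % 4 = 1 ∨ m % 4 = 2 := by omega
      rcases hr with hr | hr <;> simp [hr] at hdet <;> linarith
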